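/- Let T be a tree of diameter exactly 4 and let u be its central vertex (the unique vertex at distance at most 2 from every vertex of T). Suppose u has k neighbors of degree 1 and ℓ ≥ 4 neighbors of degree at least 2. Then γ_e(T) ≤ 4 and the order of T is at least 9. -/

import Mathlib

open SimpleGraph

/-- The contribution `(1/2)^(d-1)` of a vertex at `S`-restricted distance `d`,
with `(1/2)^∞ = 0`. -/
noncomputable def expStep (d : ℕ∞) : ℝ :=
  if h : d = ⊤ then 0 else (1 / 2 : ℝ) ^ ((d.untop h : ℤ) - 1)

/-- `expDist G S u v` is the minimum number of edges of a walk in `G` from `u` to `v`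
such that `v` is the only vertex of the walk belonging to `S` (i.e. the distance from `u`
to `v ∈ S` in `G - (S \ {v})`), and `⊤` if no such walk exists. -/
noncomputable def expDist {V : Type*} (G : SimpleGraph V) (S : Finset V) (u v : V) : ℕ∞ :=
  sInf {n : ℕ∞ | ∃ p : G.Walk u v, (∀ x ∈ p.support, x ∈ S → x = v) ∧ (p.length : ℕ∞) = n}

/-- The weight `w_{(G,S)}(u) = Σ_{v ∈ S} (1/2)^(dist_{(G,S)}(u,v) - 1)`. -/
noncomputable def expWeight {V : Type*} (G : SimpleGraph V) (S : Finset V) (u : V) : ℝ :=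
  ∑ v ∈ S, expStep (expDist G S u v)

/-- `S` is an exponential dominating set of `G`. -/
def IsExpDomSet {V : Type*} (G : SimpleGraph V) (S : Finset V) : Prop :=
  ∀ u : V, 1 ≤ expWeight G S u

/-- The exponential domination number of `G`. -/
noncomputable def expDomNum {V : Type*} (G : SimpleGraph V) : ℕ :=
  sInf {k : ℕ | ∃ S : Finset V, IsExpDomSet G S ∧ S.card = k}

theorem expStep_nonneg (d : ℕ∞) : 0 ≤ expStep d := by
  unfold expStep
  split_ifs <;> positivity

theorem le_expStep {d : ℕ∞} {n : ℕ} (h : d ≤ n) : (1 / 2 : ℝ) ^ ((n : ℤ) - 1) ≤ expStep d := by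
  lift d to ℕ using ne_top_of_le_ne_top (ENat.natCast_ne_top n) h
  have hdn : d ≤ n := by exact_mod_cast h
  have hd : expStep (d : ℕ∞) = (1 / 2 : ℝ) ^ ((d : ℤ) - 1) := by
    rw [expStep, dif_neg (ENat.natCast_ne_top d)]
    rfl
  rw [hd]
  exact zpow_le_zpow_right_of_le_one₀ (by norm_num) (by norm_num) (by omega)

theorem expDist_le_length {V : Type*} {G : SimpleGraph V} {S : Finset V} {u v : V}
    (p : G.Walk u v) (hp : ∀ x ∈ p.support, x ∈ S → x = v) : expDist G S u v ≤ p.length :=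
  sInf_le ⟨p, hp, rfl⟩

theorem card_mul_le_expWeight {V : Type*} {G : SimpleGraph V} {S A : Finset V} {u : V} (n : ℕ)
    (hA : A ⊆ S) (h : ∀ v ∈ A, expDist G S u v ≤ n) :
    A.card * (1 / 2 : ℝ) ^ ((n : ℤ) - 1) ≤ expWeight G S u := by
  calc A.card * (1 / 2 : ℝ) ^ ((n : ℤ) - 1)
      = ∑ _v ∈ A, (1 / 2 : ℝ) ^ ((n : ℤ) - 1) := by simp
    _ ≤ ∑ v ∈ A, expStep (expDist G S u v) := Finset.sum_le_sum fun v hv => le_expStep (h v hv)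
    _ ≤ expWeight G S u :=
      Finset.sum_le_sum_of_subset_of_nonneg hA fun v _ _ => expStep_nonneg _

theorem one_le_expWeight_of_mem {V : Type*} {G : SimpleGraph V} {S : Finset V} {u : V}
    (hu : u ∈ S) : 1 ≤ expWeight G S u := by
  have h := card_mul_le_expWeight (G := G) (u := u) 0 (Finset.singleton_subset_iff.2 hu) (by
    intro v hv
    obtain rfl := Finset.mem_singleton.1 hv
    exact expDist_le_length Walk.nil (by simp))
  norm_num at h
  linarith

theorem one_le_expWeight_of_adj {V : Type*} {G : SimpleGraph V} {S : Finset V} {u v : V}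
    (hu : u ∉ S) (hv : v ∈ S) (huv : G.Adj u v) : 1 ≤ expWeight G S u := by
  have h := card_mul_le_expWeight (G := G) (u := u) 1 (Finset.singleton_subset_iff.2 hv) (by
    intro w hw
    obtain rfl := Finset.mem_singleton.1 hw
    refine expDist_le_length huv.toWalk ?_
    simp [hu])
  simpa using h

/-- A vertex at distance at most two from every vertex, together with four of its neighbors,
yields an exponential dominating set consisting of these four neighbors. -/
theorem isExpDomSet_of_four_neighbors {V : Type*} {G : SimpleGraph V} (hG : G.Connected) {u : V}
    (hu : ∀ v, G.dist u v ≤ 2) {S : Finset V} (hS : ∀ v ∈ S, G.Adj u v) (hcard : S.card = 4) :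
    IsExpDomSet G S := by
  intro x
  have huS : u ∉ S := fun h => G.irrefl (hS u h)
  by_cases hx : x ∈ S
  · exact one_le_expWeight_of_mem hx
  obtain ⟨p, hp⟩ := hG.exists_walk_length_eq_dist u x
  have hp2 : p.length ≤ 2 := hp ▸ hu x
  clear hp
  match p, hp2 with
  | .nil, _ =>
    obtain ⟨v, hv⟩ := Finset.card_pos.1 (by omega : 0 < S.card)
    exact one_le_expWeight_of_adj hx hv (hS v hv)
  | .cons h .nil, _ =>
    have := card_mul_le_expWeight (G := G) (u := x) 2 (Finset.Subset.refl S) fun v hv =>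
      expDist_le_length (.cons h.symm (.cons (hS v hv) .nil)) (by simp [hx, huS])
    norm_num [hcard] at this
    linarith
  | .cons (v := w) h (.cons h' .nil), _ =>
    by_cases hw : w ∈ S
    · exact one_le_expWeight_of_adj hx hw h'.symm
    have := card_mul_le_expWeight (G := G) (u := x) 3 (Finset.Subset.refl S) fun v hv =>
      expDist_le_length (.cons h'.symm (.cons h.symm (.cons (hS v hv) .nil)))
        (by simp [hx, huS, hw])
    norm_num [hcard] at this
    linarith
  | .cons _ (.cons _ (.cons _ q)), h3 =>
    simp only [Walk.length_cons] at h3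
    omega

theorem expDomNum_le_card {V : Type*} {G : SimpleGraph V} {S : Finset V}
    (hS : IsExpDomSet G S) : expDomNum G ≤ S.card :=
  Nat.sInf_le ⟨S, hS, rfl⟩

/-- In an acyclic graph, a vertex with `m` neighbors of degree at least two forces
at least `2 * m + 1` vertices. -/
theorem two_mul_card_add_one_le_card {V : Type*} [Fintype V] [DecidableEq V]
    {G : SimpleGraph V} [DecidableRel G.Adj] (hG : G.IsAcyclic) {u : V} {S : Finset V}
    (hS : ∀ v ∈ S, G.Adj u v) (hdeg : ∀ v ∈ S, 2 ≤ G.degree v) :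
    2 * S.card + 1 ≤ Fintype.card V := by
  have hex : ∀ v : V, ∃ w, v ∈ S → G.Adj v w ∧ w ≠ u := by
    intro v
    by_cases hv : v ∈ S
    · obtain ⟨w, hw, hne⟩ := Finset.exists_mem_ne
        (s := G.neighborFinset v) (by simpa [Nat.lt_iff_add_one_le] using hdeg v hv) u
      exact ⟨w, fun _ => ⟨by simpa using hw, hne⟩⟩
    · exact ⟨v, fun h => absurd h hv⟩
  choose f hf using hex
  have hpath : ∀ {v w : V}, (h : G.Adj u v) → (h' : G.Adj v w) → w ≠ u →
      (Walk.cons h (Walk.cons h' Walk.nil)).IsPath := by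
    intro v w h h' hne
    simp [Walk.cons_isPath_iff, h.ne, h'.ne, hne.symm]
  have huniq : ∀ {w : V} (p q : G.Walk u w), p.IsPath → q.IsPath → p = q := by
    intro w p q hp hq
    exact congrArg Subtype.val ((hG.subsingleton_path u w).elim ⟨p, hp⟩ ⟨q, hq⟩)
  have hinj : Set.InjOn f S := by
    intro v hv v' hv' heq
    have hv₂ : G.Adj v' (f v) := heq ▸ (hf v' hv').1
    have := huniq _ _ (hpath (hS v hv) (hf v hv).1 (hf v hv).2)
      (hpath (hS v' hv') hv₂ (hf v hv).2)
    simpa using congrArg Walk.support this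
  have hdisj : Disjoint S (S.image f) := by
    rw [Finset.disjoint_right]
    intro w hw hwS
    obtain ⟨v, hv, rfl⟩ := Finset.mem_image.1 hw
    have hadj := hS _ hwS
    have := huniq _ _ (hpath (hS v hv) (hf v hv).1 (hf v hv).2)
      (show (Walk.cons hadj Walk.nil).IsPath by simp [Walk.cons_isPath_iff, hadj.ne])
    simpa using congrArg Walk.length this
  have hu : u ∉ S ∪ S.image f := by
    simp only [Finset.mem_union, Finset.mem_image, not_or, not_exists, not_and]
    exact ⟨fun h => G.irrefl (hS u h), fun v hv => (hf v hv).2⟩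
  have hcard := Finset.card_le_univ (insert u (S ∪ S.image f))
  rw [Finset.card_insert_of_notMem hu, Finset.card_union_of_disjoint hdisj,
    Finset.card_image_of_injOn hinj] at hcard
  omega

/-- Lemma 5(iii)(c): let `T` be a tree of diameter `4` with central vertex `u`
(the vertex at distance at most `2` from every vertex), having `k` neighbors of
degree `1` and `ℓ ≥ 4` neighbors of degree at least `2`. Then
`γ_e(T) ≤ 4` and `n(T) ≥ 9`. -/
theorem expDomNum_diam_four_ell_ge_four {V : Type*} [Fintype V] [DecidableEq V]
    (T : SimpleGraph V) [DecidableRel T.Adj] (hT : T.IsTree) (hdiam : T.diam = 4)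
    (u : V) (hu : ∀ v : V, T.dist u v ≤ 2) (k : ℕ)
    (hk : ((T.neighborFinset u).filter fun v => T.degree v = 1).card = k)
    (hl : 4 ≤ ((T.neighborFinset u).filter fun v => 2 ≤ T.degree v).card) :
    expDomNum T ≤ 4 ∧ 9 ≤ Fintype.card V := by
  obtain ⟨S, hS, hcard⟩ := Finset.exists_subset_card_eq hl
  have hadj : ∀ v ∈ S, T.Adj u v := fun v hv => by simpa using (Finset.mem_filter.1 (hS hv)).1
  have hdeg : ∀ v ∈ S, 2 ≤ T.degree v := fun v hv => (Finset.mem_filter.1 (hS hv)).2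
  have hdom := isExpDomSet_of_four_neighbors hT.1 hu hadj hcard
  have hn := two_mul_card_add_one_le_card hT.2 hadj hdeg
  exact ⟨hcard ▸ expDomNum_le_card hdom, by omega⟩
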